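/- Let b ∈ ℝ, c ≥ 0 and let ν be a Lévy measure. Define ψ̂′(u) = b + (1/2 + u)c + ∫ ((eˣ−1)e^{u(eˣ−1)} − h(x)) dν(x) for u ∈ D = {u ∈ ℝ : ∫_{x>1} e^{u(eˣ−1)} dν(x) < ∞}; ψ̂′ is nondecreasing so the limits below exist in [−∞,+∞]. Then [condition (i) or condition (ii) holds] if and only if [lim_{u→−∞} ψ̂′(u) ≥ 0, or (D = ℝ and lim_{u→+∞} ψ̂′(u) ≤ 0)]. -/

import Mathlib

open MeasureTheory Filter Set
open scoped ENNReal

/-- The truncation function `h(x) = x · 1_{|x| ≤ 1}`. -/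
noncomputable def htrunc (x : ℝ) : ℝ := if |x| ≤ 1 then x else 0

/-- The set `D = {u ∈ ℝ : ∫_{x>1} e^{u(eˣ-1)} dν(x) < ∞}`. -/
def Dset (ν : Measure ℝ) : Set ℝ :=
  {u : ℝ |
    ∫⁻ x in Set.Ioi (1 : ℝ), ENNReal.ofReal (Real.exp (u * (Real.exp x - 1))) ∂ν < ⊤}

/-- `ψ̂'(u) = b + (1/2 + u)c + ∫ ((eˣ-1)e^{u(eˣ-1)} - h(x)) dν(x)`. -/
noncomputable def psihat' (b c : ℝ) (ν : Measure ℝ) (u : ℝ) : ℝ :=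
  b + (1 / 2 + u) * c +
    ∫ x, ((Real.exp x - 1) * Real.exp (u * (Real.exp x - 1)) - htrunc x) ∂ν

/-- Condition (i): `c = 0`, `∫|h| dν < ∞`, `ν((-∞,0)) = 0`, `b - ∫ h dν ≥ 0`. -/
def CondI (b c : ℝ) (ν : Measure ℝ) : Prop :=
  c = 0 ∧ Integrable htrunc ν ∧ ν (Set.Iio 0) = 0 ∧ 0 ≤ b - ∫ x, htrunc x ∂ν

/-- Condition (ii): `c = 0`, `∫|h| dν < ∞`, `ν((0,∞)) = 0`, `b - ∫ h dν ≤ 0`. -/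
def CondII (b c : ℝ) (ν : Measure ℝ) : Prop :=
  c = 0 ∧ Integrable htrunc ν ∧ ν (Set.Ioi 0) = 0 ∧ b - ∫ x, htrunc x ∂ν ≤ 0

lemma mul_exp_mul_monotone (y : ℝ) : Monotone fun u : ℝ => y * Real.exp (u * y) := by
  intro u v huv
  rcases le_total 0 y with hy | hy
  · exact mul_le_mul_of_nonneg_left
      (Real.exp_le_exp.2 (mul_le_mul_of_nonneg_right huv hy)) hy
  · exact mul_le_mul_of_nonpos_left
      (Real.exp_le_exp.2 (mul_le_mul_of_nonpos_right huv hy)) hy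

lemma tendsto_mul_exp_mul_atBot_of_nonneg {y : ℝ} (hy : 0 ≤ y) :
    Tendsto (fun u : ℝ => y * Real.exp (u * y)) atBot (nhds 0) := by
  rcases hy.eq_or_lt with rfl | hy
  · simp
  · simpa using
      (Real.tendsto_exp_atBot.comp (tendsto_id.atBot_mul_const hy)).const_mul y

lemma tendsto_mul_exp_mul_atBot_of_neg {y : ℝ} (hy : y < 0) :
    Tendsto (fun u : ℝ => y * Real.exp (u * y)) atBot atBot :=
  (Real.tendsto_exp_atTop.comp (tendsto_id.atBot_mul_const_of_neg hy)).const_mul_atTop_of_neg hy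

section Abstract

variable {α : Type*} [MeasurableSpace α] {μ : Measure α} {Y H : α → ℝ}

/-- If `Y ≥ 0` almost everywhere and `H` is integrable, the exponential term vanishes in the
limit `u → -∞`. -/
lemma tendsto_integral_mul_exp_sub_atBot (hY : Measurable Y)
    (hint : ∀ u ≤ (-1 : ℝ), Integrable (fun x => Y x * Real.exp (u * Y x) - H x) μ)
    (hH : Integrable H μ) (hpos : ∀ᵐ x ∂μ, 0 ≤ Y x) :
    Tendsto (fun u : ℝ => ∫ x, (Y x * Real.exp (u * Y x) - H x) ∂μ) atBot
      (nhds (-∫ x, H x ∂μ)) := by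
  have hexp : ∀ u ≤ (-1 : ℝ), Integrable (fun x => Y x * Real.exp (u * Y x)) μ := fun u hu =>
    ((hint u hu).add hH).congr (.of_forall fun x => by simp)
  have h0 : Tendsto (fun u : ℝ => ∫ x, Y x * Real.exp (u * Y x) ∂μ) atBot
      (nhds (∫ _, (0 : ℝ) ∂μ)) := by
    refine tendsto_integral_filter_of_dominated_convergence
      (fun x => Y x * Real.exp (-1 * Y x)) ?_ ?_ (hexp _ le_rfl) ?_
    · exact .of_forall fun u => by fun_prop
    · filter_upwards [eventually_le_atBot (-1 : ℝ)] with u hu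
      filter_upwards [hpos] with x hx
      rw [Real.norm_of_nonneg (by positivity)]
      exact mul_exp_mul_monotone (Y x) hu
    · filter_upwards [hpos] with x hx using tendsto_mul_exp_mul_atBot_of_nonneg hx
  have h1 := h0.sub_const (∫ x, H x ∂μ)
  rw [integral_zero, zero_sub] at h1
  refine h1.congr' ?_
  filter_upwards [eventually_le_atBot (-1 : ℝ)] with u hu
  rw [integral_sub (hexp u hu) hH]

/-- If the differences of the integrals of `Y e^{uY}` stay bounded as `u → -∞`, then `Y ≥ 0`
almost everywhere and `Y e^{-Y}` is integrable. -/
lemma ae_nonneg_and_integrable_of_bounded (hY : Measurable Y)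
    (hint : ∀ u ≤ (-1 : ℝ), Integrable (fun x => Y x * Real.exp (u * Y x) - H x) μ) {K : ℝ}
    (hK : ∀ u ≤ (-1 : ℝ),
      ∫ x, (Y x * Real.exp (-1 * Y x) - Y x * Real.exp (u * Y x)) ∂μ ≤ K) :
    (∀ᵐ x ∂μ, 0 ≤ Y x) ∧ Integrable (fun x => Y x * Real.exp (-1 * Y x)) μ := by
  set u : ℕ → ℝ := fun n => -1 - n with hu
  have hu1 : ∀ n, u n ≤ -1 := fun n => by simp [hu]
  have hulim : Tendsto u atTop atBot :=
    tendsto_atBot_add_const_left _ _ (tendsto_neg_atTop_atBot.comp tendsto_natCast_atTop_atTop)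
  set G : ℕ → α → ℝ := fun n x =>
    Y x * Real.exp (-1 * Y x) - Y x * Real.exp (u n * Y x) with hG
  have hGm : ∀ n, Measurable (G n) := fun n => by fun_prop
  have hG0 : ∀ n x, 0 ≤ G n x := fun n x => sub_nonneg.2 (mul_exp_mul_monotone _ (hu1 n))
  have hGi : ∀ n, Integrable (G n) μ := fun n => by
    refine ((hint _ le_rfl).sub (hint _ (hu1 n))).congr (.of_forall fun x => ?_)
    simp [hG]
  have hbound : ∫⁻ x, liminf (fun n => ENNReal.ofReal (G n x)) atTop ∂μ ≤ ENNReal.ofReal K := by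
    refine (lintegral_liminf_le fun n => (hGm n).ennreal_ofReal).trans ?_
    refine liminf_le_of_le (by isBoundedDefault) fun b hb => ?_
    obtain ⟨n, hn⟩ := hb.exists
    refine hn.trans ?_
    rw [← ofReal_integral_eq_lintegral_ofReal (hGi n) (.of_forall (hG0 n))]
    exact ENNReal.ofReal_le_ofReal (hK _ (hu1 n))
  have hnn : ∀ᵐ x ∂μ, 0 ≤ Y x := by
    have hm : Measurable fun x => liminf (fun n => ENNReal.ofReal (G n x)) atTop :=
      .liminf fun n => (hGm n).ennreal_ofReal
    filter_upwards [ae_lt_top hm (hbound.trans_lt ENNReal.ofReal_lt_top).ne] with x hx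
    by_contra! hneg
    have hlim : Tendsto (fun n => G n x) atTop atTop := by
      have := tendsto_neg_atBot_atTop.comp ((tendsto_mul_exp_mul_atBot_of_neg hneg).comp hulim)
      exact tendsto_atTop_add_const_left _ (Y x * Real.exp (-1 * Y x)) this
    have := (ENNReal.tendsto_ofReal_nhds_top.2 hlim).liminf_eq
    exact hx.ne this
  refine ⟨hnn, by fun_prop, ?_⟩
  rw [hasFiniteIntegral_iff_ofReal (by filter_upwards [hnn] with x hx; positivity)]
  refine lt_of_eq_of_lt (lintegral_congr_ae ?_) (hbound.trans_lt ENNReal.ofReal_lt_top)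
  filter_upwards [hnn] with x hx
  have hlim : Tendsto (fun n => G n x) atTop (nhds (Y x * Real.exp (-1 * Y x))) := by
    simpa [hG, Function.comp_def] using
      ((tendsto_mul_exp_mul_atBot_of_nonneg hx).comp hulim).const_sub
        (Y x * Real.exp (-1 * Y x))
  exact (ENNReal.tendsto_ofReal hlim).liminf_eq.symm

/-- The limit at `-∞` of `u ↦ b + uc + ∫ (Y e^{uY} - H)` is nonnegative iff `c = 0`, `H` is
integrable, `Y ≥ 0` almost everywhere and `b - ∫ H ≥ 0`. -/
lemma limit_atBot_nonneg_iff (hY : Measurable Y)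
    (hint : ∀ u ≤ (-1 : ℝ), Integrable (fun x => Y x * Real.exp (u * Y x) - H x) μ)
    (b : ℝ) {c : ℝ} (hc : 0 ≤ c) :
    (∃ L : EReal, Tendsto (fun u : ℝ =>
        ((b + u * c + ∫ x, (Y x * Real.exp (u * Y x) - H x) ∂μ : ℝ) : EReal)) atBot (nhds L) ∧
      0 ≤ L) ↔
    c = 0 ∧ Integrable H μ ∧ (∀ᵐ x ∂μ, 0 ≤ Y x) ∧ 0 ≤ b - ∫ x, H x ∂μ := by
  have key : c = 0 → Integrable H μ → (∀ᵐ x ∂μ, 0 ≤ Y x) → Tendsto (fun u : ℝ =>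
      ((b + u * c + ∫ x, (Y x * Real.exp (u * Y x) - H x) ∂μ : ℝ) : EReal)) atBot
        (nhds ((b - ∫ x, H x ∂μ : ℝ) : EReal)) := by
    rintro rfl hH hpos
    refine continuous_coe_real_ereal.continuousAt.tendsto.comp ?_
    simpa [sub_eq_add_neg] using (tendsto_integral_mul_exp_sub_atBot hY hint hH hpos).const_add b
  constructor
  · rintro ⟨L, hL, hL0⟩
    set F : ℝ → ℝ := fun u => b + u * c + ∫ x, (Y x * Real.exp (u * Y x) - H x) ∂μ with hF
    have hmono : ∀ u ≤ (-1 : ℝ), ∀ v ≤ u, F v ≤ F u := fun u hu v hv =>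
      add_le_add (by gcongr) (integral_mono (hint v (hv.trans hu)) (hint u hu) fun x =>
        sub_le_sub_right (mul_exp_mul_monotone _ hv) _)
    have hF0 : ∀ u ≤ (-1 : ℝ), 0 ≤ F u := fun u hu => by
      have : L ≤ (F u : EReal) := by
        refine le_of_tendsto hL ?_
        filter_upwards [eventually_le_atBot u] with v hv
        exact_mod_cast hmono u hu v hv
      exact_mod_cast hL0.trans this
    have hsplit : ∀ u ≤ (-1 : ℝ), F u = F (-1) + (u + 1) * c -
        ∫ x, (Y x * Real.exp (-1 * Y x) - Y x * Real.exp (u * Y x)) ∂μ := fun u hu => by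
      have : ∫ x, (Y x * Real.exp (-1 * Y x) - Y x * Real.exp (u * Y x)) ∂μ =
          ∫ x, ((Y x * Real.exp (-1 * Y x) - H x) - (Y x * Real.exp (u * Y x) - H x)) ∂μ := by
        simp
      rw [this, integral_sub (hint _ le_rfl) (hint _ hu)]
      simp only [hF]
      ring
    have hint0 : ∀ u ≤ (-1 : ℝ),
        0 ≤ ∫ x, (Y x * Real.exp (-1 * Y x) - Y x * Real.exp (u * Y x)) ∂μ := fun u hu =>
      integral_nonneg fun x => sub_nonneg.2 (mul_exp_mul_monotone _ hu)
    have hc0 : c = 0 := by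
      by_contra hne
      have hcpos : 0 < c := hc.lt_of_ne' hne
      have hK := hF0 _ le_rfl
      have hu : -2 - F (-1) / c ≤ -1 := by
        have : 0 ≤ F (-1) / c := by positivity
        linarith
      have h1 := hF0 _ hu
      rw [hsplit _ hu] at h1
      have h2 := hint0 _ hu
      have h3 : (-2 - F (-1) / c + 1) * c = -c - F (-1) := by field_simp; ring
      linarith
    obtain ⟨hpos, hexp⟩ := ae_nonneg_and_integrable_of_bounded hY hint (K := F (-1))
      fun u hu => by
        have h1 := hF0 u hu
        rw [hsplit u hu, hc0] at h1
        linarith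
    have hH : Integrable H μ := 
      (hexp.sub (hint _ le_rfl)).congr (.of_forall fun x => by simp)
    refine ⟨hc0, hH, hpos, ?_⟩
    rw [tendsto_nhds_unique hL (key hc0 hH hpos)] at hL0
    exact_mod_cast hL0
  · rintro ⟨hc0, hH, hpos, hb⟩
    exact ⟨_, key hc0 hH hpos, by exact_mod_cast hb⟩

end Abstract

lemma measurable_htrunc : Measurable htrunc :=
  Measurable.ite (measurableSet_le (by fun_prop) measurable_const) measurable_id measurable_const

lemma abs_exp_sub_one_le_mul_exp_abs (t : ℝ) : |Real.exp t - 1| ≤ |t| * Real.exp |t| := by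
  rw [abs_le]
  have h1 := Real.add_one_le_exp t
  have h2 := Real.add_one_le_exp (-t)
  have h3 : Real.exp t * Real.exp (-t) = 1 := by rw [← Real.exp_add]; simp
  have h4 : Real.exp t ≤ Real.exp |t| := Real.exp_le_exp.2 (le_abs_self t)
  have h5 : (1 : ℝ) ≤ Real.exp |t| := Real.one_le_exp (abs_nonneg t)
  have h6 := neg_abs_le t
  have h7 := le_abs_self t
  have h8 := abs_nonneg t
  constructor
  · nlinarith
  · have : Real.exp t - 1 ≤ t * Real.exp t := by nlinarith [Real.exp_pos t]
    refine this.trans ?_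
    exact mul_le_mul h7 h4 (Real.exp_pos t).le h8

/-- A bound of the integrand of `psihat'` by integrable functions. -/
lemma abs_integrand_le (u x : ℝ) :
    |(Real.exp x - 1) * Real.exp (u * (Real.exp x - 1)) - htrunc x| ≤
      (4 * |u| * Real.exp (2 * |u|) + 1 + Real.exp |u|) * min (x ^ 2) 1 +
        (Ioi (1 : ℝ)).indicator (fun x => Real.exp ((u + 1) * (Real.exp x - 1))) x := by
  have hind : 0 ≤ (Ioi (1 : ℝ)).indicator (fun x => Real.exp ((u + 1) * (Real.exp x - 1))) x :=
    indicator_nonneg (fun x _ => (Real.exp_pos _).le) x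
  have hA : 0 ≤ 4 * |u| * Real.exp (2 * |u|) := by positivity
  have hB : 0 ≤ Real.exp |u| := by positivity
  rcases le_or_gt |x| 1 with hx | hx
  · have hmin : min (x ^ 2) 1 = x ^ 2 := min_eq_left ((sq_le_one_iff_abs_le_one x).2 hx)
    rw [htrunc, if_pos hx, hmin]
    set y := Real.exp x - 1 with hy
    have hyx : |y - x| ≤ x ^ 2 := Real.abs_exp_sub_one_sub_id_le hx
    have hy2 : |y| ≤ 2 * |x| := Real.abs_exp_sub_one_le hx
    have huy : |u * y| ≤ 2 * |u| * |x| := by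
      rw [abs_mul]; nlinarith [abs_nonneg u]
    have huy' : |u * y| ≤ 2 * |u| := huy.trans (mul_le_of_le_one_right (by positivity) hx)
    have he : |Real.exp (u * y) - 1| ≤ 2 * |u| * |x| * Real.exp (2 * |u|) :=
      (abs_exp_sub_one_le_mul_exp_abs _).trans
        (mul_le_mul huy (Real.exp_le_exp.2 huy') (Real.exp_pos _).le (by positivity))
    have hprod : |y * (Real.exp (u * y) - 1)| ≤
        4 * |u| * Real.exp (2 * |u|) * x ^ 2 := by
      rw [abs_mul]
      calc |y| * |Real.exp (u * y) - 1|
          ≤ (2 * |x|) * (2 * |u| * |x| * Real.exp (2 * |u|)) := by gcongr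
        _ = 4 * |u| * Real.exp (2 * |u|) * |x| ^ 2 := by ring
        _ = _ := by rw [sq_abs]
    have : y * Real.exp (u * y) - x = y * (Real.exp (u * y) - 1) + (y - x) := by ring
    rw [this]
    have := abs_add_le (y * (Real.exp (u * y) - 1)) (y - x)
    nlinarith [mul_nonneg hB (sq_nonneg x)]
  · have hmin : min (x ^ 2) 1 = 1 :=
      min_eq_right (by rw [← sq_abs]; nlinarith)
    rw [htrunc, if_neg hx.not_ge, hmin, sub_zero, abs_mul, Real.abs_exp]
    set y := Real.exp x - 1 with hy
    rcases lt_abs.1 hx with hx | hx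
    · have hy0 : 0 ≤ y := by have := Real.add_one_le_exp x; linarith
      rw [indicator_of_mem (mem_Ioi.2 hx), abs_of_nonneg hy0, add_mul u, one_mul y,
        Real.exp_add, mul_comm y]
      have : y ≤ Real.exp y := by linarith [Real.add_one_le_exp y]
      have := mul_le_mul_of_nonneg_left this (Real.exp_pos (u * y)).le
      linarith
    · have hy1 : |y| ≤ 1 := by
        have : Real.exp x ≤ 1 := Real.exp_le_one_iff.2 (by linarith)
        rw [abs_le]; constructor <;> linarith [Real.exp_pos x]
      have hle : u * y ≤ |u| := (le_abs_self _).trans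
        (by rw [abs_mul]; exact mul_le_of_le_one_right (abs_nonneg u) hy1)
      have := mul_le_mul hy1 (Real.exp_le_exp.2 hle) (Real.exp_pos _).le zero_le_one
      linarith

lemma integrable_min_sq_one {ν : Measure ℝ}
    (hν : ∫⁻ x, ENNReal.ofReal (min (x ^ 2) 1) ∂ν < ⊤) :
    Integrable (fun x : ℝ => min (x ^ 2) 1) ν :=
  ⟨by fun_prop, (hasFiniteIntegral_iff_ofReal (.of_forall fun x => by positivity)).2 hν⟩

lemma integrable_integrand {ν : Measure ℝ}
    (hν : ∫⁻ x, ENNReal.ofReal (min (x ^ 2) 1) ∂ν < ⊤) {u : ℝ} (hu : u + 1 ∈ Dset ν) :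
    Integrable (fun x =>
      (Real.exp x - 1) * Real.exp (u * (Real.exp x - 1)) - htrunc x) ν := by
  have hexp : IntegrableOn (fun x => Real.exp ((u + 1) * (Real.exp x - 1))) (Ioi 1) ν :=
    ⟨by fun_prop, (hasFiniteIntegral_iff_ofReal (.of_forall fun x => (Real.exp_pos _).le)).2 hu⟩
  refine (((integrable_min_sq_one hν).const_mul _).add
    (hexp.integrable_indicator measurableSet_Ioi)).mono' ?_ (.of_forall (abs_integrand_le u))
  have := measurable_htrunc
  fun_prop

lemma mem_Dset_of_nonpos {ν : Measure ℝ}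
    (hν : ∫⁻ x, ENNReal.ofReal (min (x ^ 2) 1) ∂ν < ⊤) {u : ℝ} (hu : u ≤ 0) : u ∈ Dset ν := by
  refine lt_of_le_of_lt ?_ hν
  refine (setLIntegral_mono' measurableSet_Ioi fun x (hx : 1 < x) => ?_).trans
    (setLIntegral_le_lintegral (Ioi 1) _)
  refine ENNReal.ofReal_le_ofReal ?_
  rw [min_eq_right (by nlinarith)]
  exact Real.exp_le_one_iff.2
    (mul_nonpos_of_nonpos_of_nonneg hu (by linarith [Real.add_one_le_exp x]))

lemma condI_iff {b c : ℝ} (hc : 0 ≤ c) {ν : Measure ℝ}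
    (hν : ∫⁻ x, ENNReal.ofReal (min (x ^ 2) 1) ∂ν < ⊤) :
    CondI b c ν ↔ ∃ L : EReal,
      Tendsto (fun u : ℝ => (psihat' b c ν u : EReal)) atBot (nhds L) ∧ 0 ≤ L := by
  have hY : Measurable fun x : ℝ => Real.exp x - 1 := by fun_prop
  have hint := fun (u : ℝ) (hu : u ≤ -1) =>
    integrable_integrand hν (mem_Dset_of_nonpos hν (show u + 1 ≤ 0 by linarith))
  have hψ : psihat' b c ν = fun u => b + c / 2 + u * c +
      ∫ x, ((Real.exp x - 1) * Real.exp (u * (Real.exp x - 1)) - htrunc x) ∂ν := by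
    funext u
    rw [psihat']
    ring
  have hneg : ν (Iio 0) = 0 ↔ ∀ᵐ x ∂ν, 0 ≤ Real.exp x - 1 := by
    rw [ae_iff]
    congr! 3
    ext x
    simp
  rw [hψ, limit_atBot_nonneg_iff hY hint (b + c / 2) hc, CondI, hneg]
  refine and_congr_right fun h => ?_
  simp [h]

lemma Dset_eq_univ_of_measure_Ioi_eq_zero {ν : Measure ℝ} (h : ν (Ioi 0) = 0) :
    Dset ν = univ := by
  refine eq_univ_of_forall fun u => ?_
  have : ν (Ioi 1) = 0 := measure_mono_null (Ioi_subset_Ioi zero_le_one) h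
  simp [Dset, setLIntegral_measure_zero _ _ this]

lemma condII_iff {b c : ℝ} (hc : 0 ≤ c) {ν : Measure ℝ}
    (hν : ∫⁻ x, ENNReal.ofReal (min (x ^ 2) 1) ∂ν < ⊤) (hD : Dset ν = univ) :
    CondII b c ν ↔ ∃ L : EReal,
      Tendsto (fun u : ℝ => (psihat' b c ν u : EReal)) atTop (nhds L) ∧ L ≤ 0 := by
  have hY : Measurable fun x : ℝ => -(Real.exp x - 1) := by fun_prop
  have hsymm : ∀ u x : ℝ, -(Real.exp x - 1) * Real.exp (u * -(Real.exp x - 1)) - -htrunc x =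
      -((Real.exp x - 1) * Real.exp (-u * (Real.exp x - 1)) - htrunc x) := fun u x => by
    rw [mul_neg, neg_mul u]
    ring
  have hint : ∀ u ≤ (-1 : ℝ), Integrable (fun x =>
      -(Real.exp x - 1) * Real.exp (u * -(Real.exp x - 1)) - -htrunc x) ν := fun u _ => by
    simp_rw [hsymm]
    exact (integrable_integrand hν (hD ▸ mem_univ _)).neg
  have hψ : ∀ u, -b - c / 2 + u * c + ∫ x, (-(Real.exp x - 1) *
      Real.exp (u * -(Real.exp x - 1)) - -htrunc x) ∂ν = -psihat' b c ν (-u) := fun u => by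
    simp_rw [hsymm]
    rw [integral_neg, psihat']
    ring
  have hpos : ν (Ioi 0) = 0 ↔ ∀ᵐ x ∂ν, 0 ≤ -(Real.exp x - 1) := by
    rw [ae_iff]
    congr! 3
    ext x
    simp
  have hlim : (∃ L : EReal, Tendsto (fun u : ℝ => (psihat' b c ν u : EReal)) atTop (nhds L) ∧
      L ≤ 0) ↔ ∃ L : EReal, Tendsto (fun u : ℝ => ((-psihat' b c ν (-u) : ℝ) : EReal)) atBot
        (nhds L) ∧ 0 ≤ L := by
    constructor
    · rintro ⟨L, hL, hL0⟩
      refine ⟨-L, ?_, EReal.neg_nonneg.2 hL0⟩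
      exact (continuous_neg.tendsto L).comp (hL.comp tendsto_neg_atBot_atTop)
    · rintro ⟨L, hL, hL0⟩
      refine ⟨-L, ?_, EReal.neg_le_zero.2 hL0⟩
      have := (continuous_neg.tendsto L).comp (hL.comp tendsto_neg_atTop_atBot)
      refine this.congr fun u => ?_
      simp
  have h := limit_atBot_nonneg_iff hY hint (-b - c / 2) hc
  simp_rw [hψ] at h
  rw [hlim, h, CondII, hpos]
  refine and_congr_right fun h => ?_
  rw [integral_neg, show (fun x => -htrunc x) = -htrunc from rfl, integrable_neg_iff]
  refine and_congr_right fun _ => and_congr_right fun _ => ?_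
  rw [h]
  constructor <;> intro h <;> linarith

/-- Lemma 5 of the paper: `(i) ∨ (ii)` holds iff
`lim_{u→-∞} ψ̂'(u) ≥ 0` or (`D = ℝ` and `lim_{u→+∞} ψ̂'(u) ≤ 0`), the limits
taken in `[-∞,+∞]` (they exist since `ψ̂'` is nondecreasing). -/
theorem stmt_5 (b c : ℝ) (hc : 0 ≤ c) (ν : Measure ℝ)
    (hν0 : ν {0} = 0)
    (hν : ∫⁻ x, ENNReal.ofReal (min (x ^ 2) 1) ∂ν < ⊤) :
    (CondI b c ν ∨ CondII b c ν) ↔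
      ((∃ L : EReal,
          Tendsto (fun u : ℝ => (psihat' b c ν u : EReal)) atBot (nhds L) ∧ 0 ≤ L) ∨
       (Dset ν = Set.univ ∧
        ∃ L : EReal,
          Tendsto (fun u : ℝ => (psihat' b c ν u : EReal)) atTop (nhds L) ∧ L ≤ 0)) := by
  rw [← condI_iff hc hν]
  refine or_congr_right ⟨fun h => ?_, fun ⟨hD, h⟩ => (condII_iff hc hν hD).2 h⟩
  have hD := Dset_eq_univ_of_measure_Ioi_eq_zero h.2.2.1
  exact ⟨hD, (condII_iff hc hν hD).1 h⟩
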